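/- arXiv:1803.06953 — 2 statements merged into one kernel-verified Lean document; each statement's English description precedes it below -/
import Mathlib

section
/- Let m > 1 and K ≥ 1, and let A : ℝ → ℝ satisfy Assumption (A) with constant K. Then for every integer n ≥ 1 there exists a function A_n : ℝ → ℝ which is infinitely differentiable with all derivatives of order ≥ 1 bounded, which satisfies Assumption (A) with constant 3K, and such that, writing 𝔞_n(r) = √(A_n′(r)), one has 𝔞_n(r) ≥ 2/n for all r ∈ ℝ and sup_{|r| ≤ n} |𝔞(r) − 𝔞_n(r)| ≤ 4/n, where 𝔞(r) = √(A′(r)). -/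
open MeasureTheory intervalIntegral

/-- `𝔞(r) = √(A'(r))`. -/
noncomputable def frakA (A : ℝ → ℝ) : ℝ → ℝ := fun r => Real.sqrt (deriv A r)

/-- `Ψ(r) = ∫_0^r 𝔞(ζ) dζ`. -/
noncomputable def PsiOf (A : ℝ → ℝ) : ℝ → ℝ := fun r => ∫ ζ in (0:ℝ)..r, frakA A ζ

/-- Assumption (A) with constants `m` and `K`. -/
def AssumptionA (m K : ℝ) (A : ℝ → ℝ) : Prop :=
  Differentiable ℝ A ∧ StrictMono A ∧ (∀ r : ℝ, A (-r) = -A r) ∧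
  (∀ r : ℝ, r ≠ 0 → DifferentiableAt ℝ (frakA A) r) ∧
  |frakA A 0| ≤ K ∧
  (∀ r : ℝ, 0 < r → |deriv (frakA A) r| ≤ K * r ^ ((m - 3) / 2)) ∧
  (∀ r : ℝ, 1 ≤ |r| → 1 ≤ K * frakA A r) ∧
  (∀ r ζ : ℝ, 1 ≤ max |r| |ζ| → |r - ζ| ≤ K * |PsiOf A r - PsiOf A ζ|) ∧
  (∀ r ζ : ℝ, max |r| |ζ| < 1 → |r - ζ| ^ ((m + 1) / 2) ≤ K * |PsiOf A r - PsiOf A ζ|)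

open Set Filter Metric
open scoped Topology ContDiff Convolution

/-- A smooth function that is constant outside a bounded interval has bounded derivatives. -/
theorem exists_bound_iteratedDeriv_of_eq_const (k : ℕ) :
    ∀ {u : ℝ → ℝ} {c T : ℝ}, ContDiff ℝ ∞ u → (∀ r, T < |r| → u r = c) →
      ∃ C : ℝ, ∀ r, |iteratedDeriv k u r| ≤ C := by
  induction k with
  | zero =>
    intro u c T hu hc
    obtain ⟨C, hC⟩ := (isCompact_Icc (a := -T) (b := T)).exists_bound_of_continuousOn
      hu.continuous.continuousOn
    refine ⟨max C |c|, fun r => ?_⟩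
    rw [iteratedDeriv_zero]
    rcases le_or_gt |r| T with h | h
    · exact (hC r (abs_le.mp h)).trans (le_max_left _ _)
    · rw [hc r h]
      exact le_max_right _ _
  | succ k ih =>
    intro u c T hu hc
    rw [iteratedDeriv_succ']
    refine ih (c := 0) (T := T) (contDiff_infty_iff_deriv.mp hu).2 fun r hr => ?_
    have : u =ᶠ[𝓝 r] fun _ => c := by
      filter_upwards [(isOpen_lt continuous_const continuous_abs).mem_nhds hr] with x hx
      exact hc x hx
    rw [this.deriv_eq, deriv_const]

/-- Smooth approximation of a Lipschitz function that is constant outside `[0, S]`: the Lipschitz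
constant is kept, and the approximation is constant near `(-∞, 0]` and near `+∞`. -/
theorem exists_contDiff_approx_of_lipschitz {L S ε : ℝ} (hL : 0 ≤ L) (hε : 0 < ε) {g : ℝ → ℝ}
    (hg : ∀ x y, |g x - g y| ≤ L * |x - y|) (hpos : ∀ x, 0 ≤ g x)
    (h0 : ∀ x ≤ 0, g x = g 0) (hS : ∀ x, S ≤ x → g x = g S) :
    ∃ F : ℝ → ℝ, ContDiff ℝ ∞ F ∧ (∀ x, 0 ≤ F x) ∧ (∀ x, |F x - g x| ≤ ε) ∧
      (∀ x, |deriv F x| ≤ L) ∧ (∃ δ > 0, ∀ x ≤ δ, F x = g 0) ∧ ∃ T, ∀ x, T ≤ x → F x = g S := by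
  obtain ⟨δ, hδ, hδε⟩ : ∃ δ > 0, 3 * L * δ ≤ ε := by
    refine ⟨ε / (3 * L + 1), by positivity, ?_⟩
    rw [← mul_div_assoc, div_le_iff₀ (by positivity)]
    nlinarith
  let φ : ContDiffBump (0 : ℝ) := ⟨δ / 2, δ, by positivity, by linarith⟩
  have hφ : φ.rOut = δ := rfl
  let G : ℝ → ℝ := fun x => g (x - 2 * δ)
  have hG : ∀ x y, |G x - G y| ≤ L * |x - y| := fun x y => by
    simpa [G] using hg (x - 2 * δ) (y - 2 * δ)
  have hGc : Continuous G :=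
    (LipschitzWith.of_dist_le_mul (K := ⟨L, hL⟩) fun x y => hG x y).continuous
  let F : ℝ → ℝ := φ.normed volume ⋆[ContinuousLinearMap.lsmul ℝ ℝ, volume] G
  have hF : ∀ x, F x = ∫ t, φ.normed volume t * G (x - t) := fun x => rfl
  have hint : ∀ x, Integrable fun t => φ.normed volume t * G (x - t) := fun x =>
    (φ.continuous_normed.mul (hGc.comp (by fun_prop))).integrable_of_hasCompactSupport
      φ.hasCompactSupport_normed.mul_right
  refine ⟨F, ?_, fun x => ?_, fun x => ?_, fun x => ?_, ⟨δ, hδ, fun x hx => ?_⟩,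
    S + 3 * δ, fun x hx => ?_⟩
  · exact φ.hasCompactSupport_normed.contDiff_convolution_left _ φ.contDiff_normed
      hGc.locallyIntegrable
  · rw [hF]
    exact integral_nonneg fun t => mul_nonneg (φ.nonneg_normed t) (hpos _)
  · have h1 : |F x - G x| ≤ L * δ := by
      refine φ.dist_normed_convolution_le hGc.aestronglyMeasurable fun y hy => ?_
      rw [hφ, mem_ball, Real.dist_eq] at hy
      exact (hG y x).trans (by gcongr)
    have h2 : |G x - g x| ≤ L * (2 * δ) := by
      refine (hg _ _).trans_eq ?_
      rw [sub_sub_cancel_left, abs_neg, abs_of_pos (by positivity)]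
    have := abs_sub_le (F x) (G x) (g x)
    linarith
  · suffices h : LipschitzWith ⟨L, hL⟩ F from norm_deriv_le_of_lipschitz h
    refine LipschitzWith.of_dist_le_mul fun y z => ?_
    change dist (F y) (F z) ≤ L * dist y z
    rw [Real.dist_eq, Real.dist_eq, hF, hF, ← integral_sub (hint y) (hint z)]
    calc _ ≤ ∫ t, φ.normed volume t * (L * |y - z|) := by
          rw [← Real.norm_eq_abs]
          refine MeasureTheory.norm_integral_le_of_norm_le (φ.integrable_normed.mul_const _)
            (ae_of_all _ fun t => ?_)
          rw [← mul_sub, Real.norm_eq_abs, abs_mul, abs_of_nonneg (φ.nonneg_normed t)]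
          have := hG (y - t) (z - t)
          rw [sub_sub_sub_cancel_right] at this
          exact mul_le_mul_of_nonneg_left this (φ.nonneg_normed t)
      _ = L * |y - z| := by rw [MeasureTheory.integral_mul_const, φ.integral_normed, one_mul]
  · have hx' : G x = g 0 := h0 _ (by linarith)
    refine (φ.normed_convolution_eq_right fun y hy => ?_).trans hx'
    rw [hφ, mem_ball, Real.dist_eq] at hy
    rw [hx']
    exact h0 _ (by linarith [(abs_lt.mp hy).2])
  · have hx' : G x = g S := hS _ (by linarith)
    refine (φ.normed_convolution_eq_right fun y hy => ?_).trans hx'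
    rw [hφ, mem_ball, Real.dist_eq] at hy
    rw [hx']
    exact hS _ (by linarith [(abs_lt.mp hy).1])

theorem frakA_nonneg (A : ℝ → ℝ) (r : ℝ) : 0 ≤ frakA A r := Real.sqrt_nonneg _

theorem frakA_neg {A : ℝ → ℝ} (hodd : ∀ r, A (-r) = -A r) (r : ℝ) :
    frakA A (-r) = frakA A r := by
  have h1 : (fun x => A (-x)) = fun x => -A x := funext hodd
  have h2 := congrFun (congrArg deriv h1) r
  rw [deriv_comp_neg, deriv.fun_neg, neg_inj] at h2
  rw [frakA, frakA, h2]

theorem frakA_abs {A : ℝ → ℝ} (hodd : ∀ r, A (-r) = -A r) (r : ℝ) :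
    frakA A |r| = frakA A r := by
  rcases abs_choice r with h | h <;> rw [h]
  exact frakA_neg hodd r

/-- The derivative bound integrates to a Lipschitz bound with respect to `r ↦ r ^ p`. -/
theorem abs_sub_le_mul_abs_rpow_sub_of_pos {a : ℝ → ℝ} {p K : ℝ} (hp : 0 < p)
    (hd : ∀ r, 0 < r → DifferentiableAt ℝ a r) (hb : ∀ r, 0 < r → |deriv a r| ≤ K * r ^ (p - 1))
    {x y : ℝ} (hx : 0 < x) (hy : 0 < y) : |a x - a y| ≤ K / p * |x ^ p - y ^ p| := by
  wlog hxy : y ≤ x generalizing x y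
  · rw [abs_sub_comm, abs_sub_comm (x ^ p)]
    exact this hy hx (le_of_not_ge hxy)
  have hmono : ∀ σ : ℝ, |σ| = 1 →
      MonotoneOn (fun r => K / p * r ^ p + σ * a r) (Ioi 0) := by
    intro σ hσ
    have hder : ∀ r ∈ Ioi (0 : ℝ), HasDerivAt (fun r => K / p * r ^ p + σ * a r)
        (K / p * (p * r ^ (p - 1)) + σ * deriv a r) r := fun r hr =>
      ((Real.hasDerivAt_rpow_const (Or.inl (ne_of_gt hr))).const_mul _).add
        ((hd r hr).hasDerivAt.const_mul σ)
    refine monotoneOn_of_deriv_nonneg (convex_Ioi 0)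
      (fun r hr => (hder r hr).continuousAt.continuousWithinAt)
      (fun r hr => (hder r (interior_subset hr)).differentiableAt.differentiableWithinAt)
      fun r hr => ?_
    have hr' := interior_subset hr
    rw [(hder r hr').deriv]
    have h1 : |σ * deriv a r| ≤ K * r ^ (p - 1) := by
      rw [abs_mul, hσ, one_mul]
      exact hb r hr'
    have h2 : K / p * (p * r ^ (p - 1)) = K * r ^ (p - 1) := by field_simp
    linarith [(abs_le.mp h1).1]
  have h1 := hmono 1 (by simp) hy hx hxy
  have h2 := hmono (-1) (by simp) hy hx hxy
  simp only at h1 h2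
  rw [abs_of_nonneg (sub_nonneg.mpr (Real.rpow_le_rpow hy.le hxy hp.le)), abs_le]
  constructor <;> linarith

/-- By the mean value theorem, `A'(0)` is a limit of values of `A'`, so the estimate away from the
origin extends to the origin. -/
theorem abs_frakA_sub_le {A : ℝ → ℝ} {p K : ℝ} (hp : 0 < p) (hK : 0 ≤ K)
    (hA : Differentiable ℝ A)
    (hd : ∀ r, 0 < r → DifferentiableAt ℝ (frakA A) r)
    (hb : ∀ r, 0 < r → |deriv (frakA A) r| ≤ K * r ^ (p - 1))
    {x y : ℝ} (hx : 0 ≤ x) (hy : 0 ≤ y) :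
    |frakA A x - frakA A y| ≤ K / p * |x ^ p - y ^ p| := by
  have hpos := fun {x y : ℝ} => @abs_sub_le_mul_abs_rpow_sub_of_pos (frakA A) p K hp hd hb x y
  have hzero : ∀ {y : ℝ}, 0 < y → |frakA A 0 - frakA A y| ≤ K / p * |0 ^ p - y ^ p| := by
    intro y hy
    have hclosed : IsClosed {v : ℝ | |√v - frakA A y| ≤ K / p * |0 ^ p - y ^ p|} :=
      isClosed_le (by fun_prop) continuous_const
    have hlim : Tendsto (slope A 0) (𝓝[>] 0) (𝓝 (deriv A 0)) :=
      (hasDerivAt_iff_tendsto_slope.mp (hA 0).hasDerivAt).mono_left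
        (nhdsWithin_mono _ fun _ h => ne_of_gt h)
    refine hclosed.mem_of_tendsto hlim ?_
    filter_upwards [Ioo_mem_nhdsGT hy] with x hx
    obtain ⟨c, hc, hcd⟩ := exists_deriv_eq_slope' A hx.1 hA.continuous.continuousOn
      hA.differentiableOn
    rw [← hcd]
    refine (hpos hc.1 hy).trans ?_
    have h1 : c ^ p ≤ y ^ p := Real.rpow_le_rpow hc.1.le (hc.2.trans hx.2).le hp.le
    have h2 : 0 ≤ c ^ p := Real.rpow_nonneg hc.1.le p
    rw [Real.zero_rpow hp.ne', zero_sub, abs_neg, abs_of_nonneg (h2.trans h1), abs_sub_comm,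
      abs_of_nonneg (sub_nonneg.mpr h1)]
    gcongr
    linarith
  rcases hx.eq_or_lt with rfl | hx
  · rcases hy.eq_or_lt with rfl | hy
    · simp
    · exact hzero hy
  · rcases hy.eq_or_lt with rfl | hy
    · rw [abs_sub_comm, abs_sub_comm (x ^ p)]
      exact hzero hx
    · exact hpos hx hy

theorem PsiOf_sub {A : ℝ → ℝ} (hA : Continuous (frakA A)) (r ζ : ℝ) :
    PsiOf A r - PsiOf A ζ = ∫ x in ζ..r, frakA A x :=
  integral_interval_sub_left (hA.intervalIntegrable _ _) (hA.intervalIntegrable _ _)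

theorem PsiOf_sub_le_PsiOf_sub {A B : ℝ → ℝ} (hA : Continuous (frakA A))
    (hB : Continuous (frakA B)) (hAB : ∀ r, |r| ≤ 1 → frakA A r ≤ frakA B r) {r ζ : ℝ}
    (hζ : -1 ≤ ζ) (hζr : ζ ≤ r) (hr : r ≤ 1) :
    |PsiOf A r - PsiOf A ζ| ≤ PsiOf B r - PsiOf B ζ := by
  rw [PsiOf_sub hA, PsiOf_sub hB,
    abs_of_nonneg (integral_nonneg hζr fun _ _ => frakA_nonneg _ _)]
  exact integral_mono_on hζr (hA.intervalIntegrable _ _) (hB.intervalIntegrable _ _) fun x hx =>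
    hAB x (abs_le.mpr ⟨hζ.trans hx.1, hx.2.trans hr⟩)

/-- The lower bound on increments of `Ψ` away from the origin passes to any `B` with `𝔟 ≥ 𝔞` on
`[-1, 1]` and `K 𝔟 ≥ 1` outside `(-1, 1)`. -/
theorem abs_sub_le_mul_abs_PsiOf_sub {A B : ℝ → ℝ} {K : ℝ} (hK : 0 ≤ K)
    (hA : Continuous (frakA A)) (hB : Continuous (frakA B))
    (hAB : ∀ r, |r| ≤ 1 → frakA A r ≤ frakA B r) (hB1 : ∀ r, 1 ≤ |r| → 1 ≤ K * frakA B r)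
    (hΨ : ∀ r ζ : ℝ, 1 ≤ max |r| |ζ| → |r - ζ| ≤ K * |PsiOf A r - PsiOf A ζ|)
    (r ζ : ℝ) (h : 1 ≤ max |r| |ζ|) : |r - ζ| ≤ K * |PsiOf B r - PsiOf B ζ| := by
  wlog hζr : ζ ≤ r generalizing r ζ
  · rw [abs_sub_comm, abs_sub_comm (PsiOf B r)]
    exact this ζ r (max_comm |r| |ζ| ▸ h) (le_of_not_ge hζr)
  have hout : ∀ {a b : ℝ}, a ≤ b → (∀ x ∈ Icc a b, 1 ≤ |x|) →
      b - a ≤ K * (PsiOf B b - PsiOf B a) := by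
    intro a b hab hx
    have : ∫ _ in a..b, (1 : ℝ) ≤ ∫ x in a..b, K * frakA B x :=
      integral_mono_on hab (by simp) ((hB.intervalIntegrable _ _).const_mul K)
        fun x h => hB1 x (hx x h)
    rw [intervalIntegral.integral_const_mul] at this
    rw [PsiOf_sub hB]
    simpa using this
  rw [abs_of_nonneg (sub_nonneg.mpr hζr)]
  refine le_trans ?_ (mul_le_mul_of_nonneg_left (le_abs_self _) hK)
  rcases le_or_gt 1 ζ with h1 | h1
  · exact hout hζr fun x hx => h1.trans (hx.1.trans (le_abs_self x))
  rcases le_or_gt r (-1) with h2 | h2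
  · exact hout hζr fun x hx => (le_neg.mpr (hx.2.trans h2)).trans (neg_le_abs x)
  have hleft : max ζ (-1) - ζ ≤ K * (PsiOf B (max ζ (-1)) - PsiOf B ζ) := by
    rcases le_total ζ (-1) with h3 | h3
    · rw [max_eq_right h3]
      exact hout h3 fun x hx => (le_neg.mpr hx.2).trans (neg_le_abs x)
    · simp [max_eq_left h3]
  have hright : r - min r 1 ≤ K * (PsiOf B r - PsiOf B (min r 1)) := by
    rcases le_total r 1 with h3 | h3
    · simp [min_eq_left h3]
    · rw [min_eq_right h3]
      exact hout h3 fun x hx => hx.1.trans (le_abs_self x)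
  have hle : max ζ (-1) ≤ min r 1 :=
    max_le (le_min hζr h1.le) (le_min h2.le (by norm_num))
  have hend : 1 ≤ max |min r 1| |max ζ (-1)| := by
    rcases le_max_iff.mp h with h3 | h3
    · rcases le_abs.mp h3 with h4 | h4
      · simp [min_eq_right h4]
      · linarith
    · rcases le_abs.mp h3 with h4 | h4
      · linarith
      · simp [max_eq_right (show ζ ≤ -1 by linarith)]
  have hmid : min r 1 - max ζ (-1) ≤ K * (PsiOf B (min r 1) - PsiOf B (max ζ (-1))) :=
    (le_abs_self _).trans ((hΨ _ _ hend).trans (mul_le_mul_of_nonneg_left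
      (PsiOf_sub_le_PsiOf_sub hA hB hAB (le_max_right _ _) hle (min_le_right _ _)) hK))
  linarith

theorem hasDerivAt_integral_sq {b : ℝ → ℝ} (hb : Continuous b) (r : ℝ) :
    HasDerivAt (fun r => ∫ x in (0 : ℝ)..r, b x ^ 2) (b r ^ 2) r :=
  have h : Continuous fun x => b x ^ 2 := hb.pow 2
  integral_hasDerivAt_right (h.intervalIntegrable _ _) (h.stronglyMeasurableAtFilter _ _)
    h.continuousAt

theorem approximation_of_A (m K : ℝ) (hm : 1 < m) (hK : 1 ≤ K)
    (A : ℝ → ℝ) (hA : AssumptionA m K A) :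
    ∀ n : ℕ, 1 ≤ n → ∃ An : ℝ → ℝ,
      ContDiff ℝ (⊤ : ℕ∞) An ∧
      (∀ k : ℕ, 1 ≤ k → ∃ C : ℝ, ∀ r : ℝ, |iteratedDeriv k An r| ≤ C) ∧
      AssumptionA m (3 * K) An ∧
      (∀ r : ℝ, 2 / (n : ℝ) ≤ frakA An r) ∧
      (∀ r : ℝ, |r| ≤ (n : ℝ) → |frakA A r - frakA An r| ≤ 4 / (n : ℝ)) := by
  intro n hn
  obtain ⟨hAd, hAm, hodd, had, ha0, hab, ha1, hΨ1, hΨ2⟩ := hA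
  have hK0 : 0 ≤ K := zero_le_one.trans hK
  have hn1 : (1 : ℝ) ≤ n := by exact_mod_cast hn
  have hn0 : (0 : ℝ) < n := by linarith
  obtain ⟨p, hp, hmp⟩ : ∃ p : ℝ, 0 < p ∧ (m - 3) / 2 = p - 1 :=
    ⟨(m - 1) / 2, by linarith, by ring⟩
  rw [hmp] at hab
  have hlip := fun {x y : ℝ} => @abs_frakA_sub_le A p K hp hK0 hAd
    (fun r hr => had r hr.ne') hab x y
  have hacont : Continuous (frakA A) := by
    refine continuous_iff_continuousAt.mpr fun r => ?_
    refine tendsto_iff_dist_tendsto_zero.mpr (squeeze_zero (fun _ => dist_nonneg)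
      (g := fun x => K / p * |(|x| ^ p) - |r| ^ p|) (fun x => ?_) ?_)
    · rw [Real.dist_eq, ← frakA_abs hodd x, ← frakA_abs hodd r]
      exact hlip (abs_nonneg x) (abs_nonneg r)
    · have : Continuous fun x : ℝ => K / p * |(|x| ^ p) - |r| ^ p| :=
        continuous_const.mul (((continuous_abs.rpow_const fun _ => Or.inr hp.le).sub
          continuous_const).abs)
      simpa using this.tendsto r
  have hroot : ∀ {x : ℝ}, 0 ≤ x → (x ^ p⁻¹) ^ p = x := fun hx => Real.rpow_inv_rpow hx hp.ne'
  let P : ℝ → ℝ := fun s => min (max s 0) ((n : ℝ) ^ p)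
  have hnp : 0 ≤ (n : ℝ) ^ p := Real.rpow_nonneg hn0.le p
  have hP0 : ∀ s, 0 ≤ P s := fun s => le_min (le_max_right _ _) hnp
  have hPlip : ∀ s t, |P s - P t| ≤ |s - t| := fun s t =>
    ((abs_min_sub_min_le_max _ _ _ _).trans (by simp)).trans
      ((abs_max_sub_max_le_max s 0 t 0).trans (by simp))
  have hPpow : ∀ {r : ℝ}, 0 ≤ r → P (r ^ p) ^ p⁻¹ = min r n := by
    intro r hr
    simp only [P]
    rw [max_eq_left (Real.rpow_nonneg hr p)]
    rcases le_total r n with h | h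
    · rw [min_eq_left h, min_eq_left (Real.rpow_le_rpow hr h hp.le),
        Real.rpow_rpow_inv hr hp.ne']
    · rw [min_eq_right h, min_eq_right (Real.rpow_le_rpow hn0.le h hp.le),
        Real.rpow_rpow_inv hn0.le hp.ne']
  obtain ⟨F, hFs, hFpos, hFg, hF', ⟨δ, hδ, hFδ⟩, T, hFT⟩ :=
    exists_contDiff_approx_of_lipschitz (L := K / p) (S := (n : ℝ) ^ p) (ε := 1 / n)
      (g := fun s => frakA A (P s ^ p⁻¹)) (by positivity) (by positivity)
      (fun s t => by
        refine (hlip (Real.rpow_nonneg (hP0 s) _) (Real.rpow_nonneg (hP0 t) _)).trans ?_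
        rw [hroot (hP0 s), hroot (hP0 t)]
        exact mul_le_mul_of_nonneg_left (hPlip s t) (by positivity))
      (fun s => frakA_nonneg _ _)
      (fun s hs => by simp only [P, max_eq_right hs, max_self])
      (fun s hs => by simp only [P, min_eq_right (hs.trans (le_max_left s 0)),
        min_eq_right (le_max_left ((n : ℝ) ^ p) 0)])
  have hP00 : P 0 ^ p⁻¹ = 0 := by
    have := hPpow le_rfl
    rwa [Real.zero_rpow hp.ne', min_eq_left hn0.le] at this
  simp only [hP00] at hFδ
  have hFr : ∀ r : ℝ, |F (|r| ^ p) - frakA A (min |r| n)| ≤ 1 / n := fun r => by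
    have := hFg (|r| ^ p)
    rwa [hPpow (abs_nonneg r)] at this
  let b : ℝ → ℝ := fun r => 2 / n + F (|r| ^ p)
  have h2n : (0 : ℝ) < 2 / n := by positivity
  have hb2 : ∀ r, 2 / (n : ℝ) ≤ b r := fun r => le_add_of_nonneg_right (hFpos _)
  have hb0 : ∀ r, 0 < b r := fun r => h2n.trans_le (hb2 r)
  have hbs : ContDiff ℝ ∞ b := by
    refine contDiff_iff_contDiffAt.mpr fun r => ?_
    rcases eq_or_ne r 0 with rfl | hr
    · have hlim : Tendsto (fun r : ℝ => |r| ^ p) (𝓝 0) (𝓝 0) := by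
        have := (continuous_abs.rpow_const fun _ => Or.inr hp.le : Continuous fun r : ℝ => |r| ^ p)
        simpa [Real.zero_rpow hp.ne'] using this.tendsto 0
      refine (contDiffAt_const (c := 2 / (n : ℝ) + frakA A 0)).congr_of_eventuallyEq ?_
      filter_upwards [hlim.eventually_le_const hδ] with x hx
      simp only [b, hFδ _ hx]
    · exact contDiffAt_const.add (hFs.contDiffAt.comp r
        ((contDiffAt_abs hr).rpow_const_of_ne (abs_ne_zero.mpr hr)))
  have hbT : ∃ c R : ℝ, ∀ r, R < |r| → b r = c := by
    refine ⟨_, (max T 0) ^ p⁻¹, fun r hr => congrArg (2 / (n : ℝ) + ·) (hFT _ ?_)⟩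
    refine (le_max_left T 0).trans ?_
    rw [← hroot (le_max_right T 0)]
    exact Real.rpow_le_rpow (by positivity) hr.le hp.le
  have hbneg : ∀ r, b (-r) = b r := fun r => by simp only [b, abs_neg]
  have hba : ∀ r : ℝ, |r| ≤ n → frakA A r ≤ b r ∧ b r ≤ frakA A r + 4 / n := by
    intro r hr
    have h := hFr r
    rw [min_eq_left hr, frakA_abs hodd, abs_le] at h
    have h4 : (4 : ℝ) / n = 4 * (1 / n) := by ring
    have h2 : (2 : ℝ) / n = 2 * (1 / n) := by ring
    have h1 : (0 : ℝ) < 1 / n := by positivity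
    constructor <;> simp only [b] <;> linarith
  have hb1 : ∀ r, 1 ≤ |r| → 1 ≤ K * b r := by
    intro r hr
    refine (ha1 (min |r| n) ((le_min hr hn1).trans (le_abs_self _))).trans ?_
    have h2 : (2 : ℝ) / n = 2 * (1 / n) := by ring
    have h1 : (0 : ℝ) < 1 / n := by positivity
    refine mul_le_mul_of_nonneg_left ?_ hK0
    simp only [b]
    linarith [(abs_le.mp (hFr r)).1]
  have hbder : ∀ r, 0 < r → |deriv b r| ≤ K * r ^ (p - 1) := by
    intro r hr
    have hd : HasDerivAt (fun r : ℝ => 2 / (n : ℝ) + F (r ^ p))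
        (deriv F (r ^ p) * (p * r ^ (p - 1))) r :=
      ((hFs.differentiable (by simp) _).hasDerivAt.comp r
        (Real.hasDerivAt_rpow_const (Or.inl hr.ne'))).const_add _
    have heq : b =ᶠ[𝓝 r] fun r : ℝ => 2 / (n : ℝ) + F (r ^ p) := by
      filter_upwards [lt_mem_nhds hr] with x hx
      simp only [b, abs_of_pos hx]
    rw [heq.deriv_eq, hd.deriv, abs_mul, abs_of_nonneg (by positivity : 0 ≤ p * r ^ (p - 1))]
    calc _ ≤ K / p * (p * r ^ (p - 1)) := by gcongr; exact hF' _
      _ = K * r ^ (p - 1) := by field_simp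
  have hbc := hbs.continuous
  let B : ℝ → ℝ := fun r => ∫ x in (0 : ℝ)..r, b x ^ 2
  have hBd := hasDerivAt_integral_sq hbc
  have hBderiv : deriv B = fun r => b r ^ 2 := funext fun r => (hBd r).deriv
  have hBb : frakA B = b := by
    funext r
    rw [frakA, hBderiv, Real.sqrt_sq (hb0 r).le]
  have hBc : Continuous (frakA B) := hBb ▸ hbc
  have hAB : ∀ r, |r| ≤ 1 → frakA A r ≤ frakA B r := fun r hr => by
    rw [hBb]
    exact (hba r (hr.trans hn1)).1
  have hweak : ∀ {x : ℝ}, 0 ≤ x → K * x ≤ 3 * K * x := fun hx => by nlinarith [mul_nonneg hK0 hx]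
  refine ⟨B, contDiff_infty_iff_deriv.mpr ⟨fun r => (hBd r).differentiableAt, ?_⟩, fun k hk => ?_,
    ⟨fun r => (hBd r).differentiableAt, ?_, fun r => ?_, fun r _ => ?_, ?_, fun r hr => ?_,
      fun r hr => ?_, fun r ζ h => ?_, fun r ζ h => ?_⟩, fun r => ?_, fun r hr => ?_⟩
  · rw [hBderiv]
    exact hbs.pow 2
  · obtain ⟨k, rfl⟩ := Nat.exists_eq_add_of_le' hk
    obtain ⟨c, R, hc⟩ := hbT
    rw [iteratedDeriv_succ', hBderiv]
    exact exists_bound_iteratedDeriv_of_eq_const k (hbs.pow 2) (c := c ^ 2) (T := R)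
      fun r hr => by rw [hc r hr]
  · refine strictMono_of_deriv_pos fun r => ?_
    rw [hBderiv]
    exact pow_pos (hb0 r) 2
  · have h := integral_comp_neg (a := 0) (b := r) fun x => b x ^ 2
    simp only [hbneg, neg_zero] at h
    simp only [B]
    rw [h, intervalIntegral.integral_symm]
  · rw [hBb]
    exact hbs.differentiable (by simp) r
  · rw [hBb, abs_of_pos (hb0 0)]
    have h1 : (2 : ℝ) / n ≤ 2 := div_le_self zero_le_two hn1
    have h2 : b 0 = 2 / n + frakA A 0 := by
      simp only [b, abs_zero, Real.zero_rpow hp.ne', hFδ 0 hδ.le]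
    linarith [le_abs_self (frakA A 0)]
  · rw [hBb, hmp]
    exact (hbder r hr).trans (hweak (Real.rpow_nonneg hr.le _))
  · rw [hBb]
    exact (hb1 r hr).trans (hweak (hb0 r).le)
  · exact (abs_sub_le_mul_abs_PsiOf_sub hK0 hacont hBc hAB (hBb ▸ hb1) hΨ1 r ζ h).trans
      (hweak (abs_nonneg _))
  · refine (hΨ2 r ζ h).trans (le_trans ?_ (hweak (abs_nonneg _)))
    refine mul_le_mul_of_nonneg_left ?_ hK0
    obtain ⟨hr, hζ⟩ := max_lt_iff.mp h
    rw [abs_lt] at hr hζ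
    rcases le_total ζ r with h | h
    · exact (PsiOf_sub_le_PsiOf_sub hacont hBc hAB hζ.1.le h hr.2.le).trans (le_abs_self _)
    · rw [abs_sub_comm, abs_sub_comm (PsiOf B r)]
      exact (PsiOf_sub_le_PsiOf_sub hacont hBc hAB hr.1.le h hζ.2.le).trans (le_abs_self _)
  · rw [hBb]
    exact hb2 r
  · rw [hBb, abs_sub_comm, abs_of_nonneg (sub_nonneg.mpr (hba r hr).1)]
    linarith [(hba r hr).2]
end

section
/- Let T > 0, let (X, μ) and (Y, ν) be finite measure spaces, and let C, L ≥ 0. Let v : [0,T] × Y → ℝ and f : [0,T] × X → ℝ be integrable; let h : [0,T] × X × ℝ → ℝ be measurable with |h(t,x,a)| ≤ C and |h(t,x,a) − h(t,x,b)| ≤ C|a − b| for all t, x, a, b; let g : [0,T] × X × [0,T] × Y → ℝ be measurable and bounded by L, with |g(t,x,s,y) − g(t,x,t,y)| ≤ L|t − s| for all t, s, x, y, and such that for some τ ∈ (0, T/2) one has g(t,x,s,y) = 0 unless both t and s lie in [τ, T − τ]. Let ρ̄_θ be either r ↦ ρ_θ(r) or r ↦ ρ_θ(−r). Then, as θ →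 0, ∫_0^T ∫_0^T ∫_X ∫_Y h(t,x,v(s,y)) f(t,x) g(t,x,s,y) ρ̄_θ(t − s) dν(y) dμ(x) ds dt converges to ∫_0^T ∫_X ∫_Y h(t,x,v(t,y)) f(t,x) g(t,x,t,y) dν(y) dμ(x) dt. -/
open MeasureTheory Filter

/-- A family of probability densities on `ℝ` indexed by `θ > 0`, bounded by `2 / θ` and
supported in `[-θ, θ]`. -/
structure IsConcentratingKernel (k : ℝ → ℝ → ℝ) : Prop where
  measurable : ∀ θ, Measurable (k θ)
  nonneg : ∀ θ, 0 < θ → ∀ r, 0 ≤ k θ r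
  le : ∀ θ, 0 < θ → ∀ r, k θ r ≤ 2 / θ
  eq_zero : ∀ θ, 0 < θ → ∀ r, θ < |r| → k θ r = 0
  integral_eq_one : ∀ θ, 0 < θ → ∫ r, k θ r = 1

namespace IsConcentratingKernel

variable {k : ℝ → ℝ → ℝ} {θ : ℝ}

theorem integrable (hk : IsConcentratingKernel k) (hθ : 0 < θ) : Integrable (k θ) := by
  by_contra hn
  have := hk.integral_eq_one θ hθ
  rw [integral_undef hn] at this
  exact zero_ne_one this

theorem integrable_sub_left (hk : IsConcentratingKernel k) (hθ : 0 < θ) (t : ℝ) :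
    Integrable fun s => k θ (t - s) :=
  (hk.integrable hθ).comp_sub_left t

theorem integral_sub_left (hk : IsConcentratingKernel k) (hθ : 0 < θ) (t : ℝ) :
    ∫ s, k θ (t - s) = 1 := by
  rw [integral_sub_left_eq_self (k θ) volume t, hk.integral_eq_one θ hθ]

theorem setIntegral_le_one (hk : IsConcentratingKernel k) (hθ : 0 < θ) (t : ℝ) (S : Set ℝ) :
    ∫ s in S, k θ (t - s) ≤ 1 := by
  rw [← hk.integral_sub_left hθ t]
  exact setIntegral_le_integral (hk.integrable_sub_left hθ t)
    (.of_forall fun s => hk.nonneg θ hθ _)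

theorem setIntegral_eq_one (hk : IsConcentratingKernel k) (hθ : 0 < θ) {t : ℝ} {S : Set ℝ}
    (hS : Metric.closedBall t θ ⊆ S) : ∫ s in S, k θ (t - s) = 1 := by
  rw [← hk.integral_sub_left hθ t]
  refine setIntegral_eq_integral_of_forall_compl_eq_zero fun s hs => hk.eq_zero θ hθ _ ?_
  by_contra hle
  exact hs (hS (by rw [Metric.mem_closedBall, Real.dist_eq, abs_sub_comm]; exact not_lt.1 hle))

/-- The mollification over `S` of a bounded function whose oscillation near `t` is controlled by
that of a function having `t` as a Lebesgue point. -/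
theorem tendsto_setIntegral_mul (hk : IsConcentratingKernel k) {φ u : ℝ → ℝ} {t A B : ℝ}
    {S : Set ℝ} (hS : S ∈ nhds t) (hSm : MeasurableSet S) (hu : Integrable u)
    (hut : Tendsto (fun θ => ⨍ s in Metric.closedBall t θ, |u s - u t|)
      (nhdsWithin 0 (Set.Ioi 0)) (nhds 0))
    (hφm : AEStronglyMeasurable φ (volume.restrict S)) (hφA : ∀ s, |φ s| ≤ A) (hB : 0 ≤ B)
    (hφ : ∀ s ∈ S, |φ s - φ t| ≤ B * (|u s - u t| + |t - s|)) :
    Tendsto (fun θ => ∫ s in S, φ s * k θ (t - s)) (nhdsWithin 0 (Set.Ioi 0)) (nhds (φ t)) := by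
  obtain ⟨ε, hε, hεS⟩ := Metric.nhds_basis_closedBall.mem_iff.1 hS
  have hlim : Tendsto (fun θ : ℝ => 4 * B * (⨍ s in Metric.closedBall t θ, |u s - u t|)
      + 4 * B * θ) (nhdsWithin 0 (Set.Ioi 0)) (nhds 0) := by
    have h2 : Tendsto (fun θ : ℝ => θ) (nhdsWithin 0 (Set.Ioi 0)) (nhds 0) :=
      tendsto_nhdsWithin_of_tendsto_nhds tendsto_id
    simpa using (hut.const_mul (4 * B)).add (h2.const_mul (4 * B))
  rw [tendsto_iff_norm_sub_tendsto_zero]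
  refine squeeze_zero' (.of_forall fun _ => norm_nonneg _) ?_ hlim
  filter_upwards [Ioc_mem_nhdsGT hε] with θ hθ
  have hθ0 : 0 < θ := hθ.1
  have hone := hk.setIntegral_eq_one hθ0
    ((Metric.closedBall_subset_closedBall hθ.2).trans hεS)
  have hkS : Integrable (fun s => k θ (t - s)) (volume.restrict S) :=
    (hk.integrable_sub_left hθ0 t).integrableOn
  have hsub : (∫ s in S, φ s * k θ (t - s)) - φ t = ∫ s in S, (φ s - φ t) * k θ (t - s) := by
    simp_rw [sub_mul]
    rw [integral_sub (hkS.bdd_mul hφm (.of_forall hφA)) (hkS.const_mul _),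
      integral_const_mul, hone, mul_one]
  have hosc : IntegrableOn (fun s => |u s - u t|) (Metric.closedBall t θ) :=
    (hu.integrableOn.sub (integrableOn_const measure_closedBall_lt_top.ne)).abs
  have hbound : IntegrableOn (fun s => B * (2 / θ) * (|u s - u t| + θ))
      (Metric.closedBall t θ) :=
    (hosc.add (integrableOn_const measure_closedBall_lt_top.ne)).const_mul _
  rw [hsub]
  calc ‖∫ s in S, (φ s - φ t) * k θ (t - s)‖
      ≤ ∫ s in S, (Metric.closedBall t θ).indicator
          (fun s => B * (2 / θ) * (|u s - u t| + θ)) s := by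
        refine norm_integral_le_of_norm_le
          (hbound.integrable_indicator Metric.isClosed_closedBall.measurableSet).integrableOn ?_
        filter_upwards [ae_restrict_mem hSm] with s hs
        by_cases hb : s ∈ Metric.closedBall t θ
        · rw [Set.indicator_of_mem hb, norm_mul, Real.norm_eq_abs, Real.norm_eq_abs,
            abs_of_nonneg (hk.nonneg θ hθ0 _)]
          have hts : |t - s| ≤ θ := by
            rwa [Metric.mem_closedBall, Real.dist_eq, abs_sub_comm] at hb
          calc |φ s - φ t| * k θ (t - s) ≤ (B * (|u s - u t| + θ)) * (2 / θ) := by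
                refine mul_le_mul ((hφ s hs).trans ?_) (hk.le θ hθ0 _) (hk.nonneg θ hθ0 _)
                  (by positivity)
                gcongr
            _ = _ := by ring
        · rw [Set.indicator_of_notMem hb, hk.eq_zero θ hθ0 _, mul_zero, norm_zero]
          rwa [Metric.mem_closedBall, Real.dist_eq, abs_sub_comm, not_le] at hb
    _ ≤ ∫ s in Metric.closedBall t θ, B * (2 / θ) * (|u s - u t| + θ) := by
        rw [← integral_indicator Metric.isClosed_closedBall.measurableSet]
        refine setIntegral_le_integral
          (hbound.integrable_indicator Metric.isClosed_closedBall.measurableSet)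
          (.of_forall fun s => Set.indicator_nonneg (fun s _ => by positivity) s)
    _ = 4 * B * (⨍ s in Metric.closedBall t θ, |u s - u t|) + 4 * B * θ := by
        rw [integral_const_mul, integral_add hosc
          (integrableOn_const measure_closedBall_lt_top.ne), setIntegral_const,
          setAverage_eq, Real.volume_real_closedBall hθ0.le, smul_eq_mul, smul_eq_mul]
        field_simp
        ring

end IsConcentratingKernel

theorem isConcentratingKernel_rescale {ρ : ℝ → ℝ} (hρ_cont : Continuous ρ)
    (hρ_nonneg : ∀ r, 0 ≤ ρ r) (hρ_bdd : ∀ r, ρ r ≤ 2)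
    (hρ_supp : ∀ r, r ∉ Set.Ioo (0 : ℝ) 1 → ρ r = 0) (hρ_int : (∫ r, ρ r) = 1) :
    IsConcentratingKernel fun θ r => θ⁻¹ * ρ (θ⁻¹ * r) where
  measurable θ := (hρ_cont.comp (continuous_const_mul θ⁻¹)).measurable.const_mul _
  nonneg θ hθ r := mul_nonneg (inv_nonneg.2 hθ.le) (hρ_nonneg _)
  le θ hθ r := by
    rw [div_eq_inv_mul]
    exact mul_le_mul_of_nonneg_left (hρ_bdd _) (inv_nonneg.2 hθ.le)
  eq_zero θ hθ r hr := by
    rw [hρ_supp, mul_zero]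
    rintro ⟨h0, h1⟩
    have hr0 : 0 < r := pos_of_mul_pos_right h0 (inv_nonneg.2 hθ.le)
    rw [inv_mul_lt_iff₀ hθ, mul_one] at h1
    rw [abs_of_pos hr0] at hr
    exact lt_asymm hr h1
  integral_eq_one θ hθ := by
    rw [integral_const_mul, Measure.integral_comp_mul_left, hρ_int, inv_inv, abs_of_pos hθ,
      smul_eq_mul, mul_one, inv_mul_cancel₀ hθ.ne']

theorem IsConcentratingKernel.comp_neg {k : ℝ → ℝ → ℝ} (hk : IsConcentratingKernel k) :
    IsConcentratingKernel fun θ r => k θ (-r) where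
  measurable θ := (hk.measurable θ).comp measurable_neg
  nonneg θ hθ r := hk.nonneg θ hθ _
  le θ hθ r := hk.le θ hθ _
  eq_zero θ hθ r hr := hk.eq_zero θ hθ _ (by rwa [abs_neg])
  integral_eq_one θ hθ := by
    rw [integral_neg_eq_self (k θ) volume, hk.integral_eq_one θ hθ]

section Fubini

variable {α β γ δ : Type*} [MeasurableSpace α] [MeasurableSpace β] [MeasurableSpace γ]
  [MeasurableSpace δ] {μa : Measure α} {μb : Measure β} {μc : Measure γ} {μd : Measure δ}
  [SFinite μb] [SFinite μd]

theorem integrable_comp_prodAssoc {F : (α × γ) × (β × δ) → ℝ}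
    (hF : Integrable F ((μa.prod μc).prod (μb.prod μd))) :
    Integrable (fun z : ((α × γ) × β) × δ => F (z.1.1, (z.1.2, z.2)))
      (((μa.prod μc).prod μb).prod μd) :=
  ((measurePreserving_prodAssoc (μa.prod μc) μb μd).integrable_comp_emb
    (MeasurableEquiv.measurableEmbedding _)).2 hF

variable [SFinite μa] [SFinite μc]

theorem integral_integral_integral_integral_eq_integral_prod {F : (α × γ) × (β × δ) → ℝ}
    (hF : Integrable F ((μa.prod μc).prod (μb.prod μd))) :
    ∫ a, ∫ b, ∫ c, ∫ d, F ((a, c), (b, d)) ∂μd ∂μc ∂μb ∂μa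
      = ∫ p, F p ∂((μa.prod μc).prod (μb.prod μd)) := by
  have hassoc := (measurePreserving_prodAssoc μa μc (μb.prod μd)).symm
  have hF' : Integrable (fun z => F (MeasurableEquiv.prodAssoc.symm z)) _ :=
    (hassoc.integrable_comp_emb (MeasurableEquiv.measurableEmbedding _)).2 hF
  rw [← hassoc.integral_comp', integral_prod _ hF']
  refine integral_congr_ae ?_
  filter_upwards [hF'.prod_right_ae] with a ha
  have hassoc₂ := measurePreserving_prodAssoc μc μb μd
  have hG : Integrable (fun z : (γ × β) × δ => F ((a, z.1.1), (z.1.2, z.2))) _ :=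
    (hassoc₂.integrable_comp_emb (MeasurableEquiv.measurableEmbedding _)).2 ha
  refine Eq.trans ?_ (hassoc₂.integral_comp' _)
  exact ((integral_prod _ hG).trans (integral_prod_symm _ hG.integral_prod_left)).symm

theorem aestronglyMeasurable_integral_integral {F : (α × γ) × (β × δ) → ℝ}
    (hF : Integrable F ((μa.prod μc).prod (μb.prod μd))) :
    AEStronglyMeasurable (fun d => ∫ p, ∫ b, F (p, (b, d)) ∂μb ∂(μa.prod μc)) μd := by
  have hF' := integrable_comp_prodAssoc hF
  refine hF'.integral_prod_right.aestronglyMeasurable.congr ?_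
  filter_upwards [hF'.prod_left_ae] with d hd
  exact integral_prod _ hd

theorem integral_prod_eq_integral_integral_integral {F : (α × γ) × (β × δ) → ℝ}
    (hF : Integrable F ((μa.prod μc).prod (μb.prod μd))) :
    ∫ p, F p ∂((μa.prod μc).prod (μb.prod μd))
      = ∫ d, ∫ p, ∫ b, F (p, (b, d)) ∂μb ∂(μa.prod μc) ∂μd := by
  have hF' := integrable_comp_prodAssoc hF
  rw [← (measurePreserving_prodAssoc (μa.prod μc) μb μd).integral_comp']
  refine (integral_prod_symm _ hF').trans (integral_congr_ae ?_)
  filter_upwards [hF'.prod_left_ae] with d hd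
  exact integral_prod _ hd

end Fubini

theorem aemeasurable_comp_mul_comp {X Y Ω : Type*} [MeasurableSpace X] [MeasurableSpace Y]
    [MeasurableSpace Ω] {m : Measure Ω} {h : ℝ → X → ℝ → ℝ} {g : ℝ → X → ℝ → Y → ℝ}
    (hh_meas : Measurable fun p : ℝ × X × ℝ => h p.1 p.2.1 p.2.2)
    (hg_meas : Measurable fun p : ℝ × X × ℝ × Y => g p.1 p.2.1 p.2.2.1 p.2.2.2)
    {t s w : Ω → ℝ} {x : Ω → X} {y : Ω → Y} (ht : Measurable t) (hs : Measurable s)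
    (hx : Measurable x) (hy : Measurable y) (hw : AEMeasurable w m) :
    AEMeasurable (fun ω => h (t ω) (x ω) (w ω) * g (t ω) (x ω) (s ω) (y ω)) m :=
  (hh_meas.comp_aemeasurable (ht.aemeasurable.prodMk (hx.aemeasurable.prodMk hw))).mul
    (hg_meas.comp (ht.prodMk (hx.prodMk (hs.prodMk hy)))).aemeasurable

theorem variable_doubling_time_convergence
    (T : ℝ) (hT : 0 < T)
    (X Y : Type*) [MeasurableSpace X] [MeasurableSpace Y]
    (μ : Measure X) (ν : Measure Y) [IsFiniteMeasure μ] [IsFiniteMeasure ν]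
    (C L : ℝ) (hC : 0 ≤ C) (hL : 0 ≤ L)
    (ρ : ℝ → ℝ) (hρ_smooth : ContDiff ℝ (⊤ : ℕ∞) ρ) (hρ_nonneg : ∀ r, 0 ≤ ρ r)
    (hρ_bdd : ∀ r, ρ r ≤ 2) (hρ_supp : ∀ r, r ∉ Set.Ioo (0 : ℝ) 1 → ρ r = 0)
    (hρ_int : (∫ r, ρ r) = 1)
    (v : ℝ → Y → ℝ) (f : ℝ → X → ℝ)
    (hv : Integrable (fun p : ℝ × Y => v p.1 p.2) ((volume.restrict (Set.Icc 0 T)).prod ν))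
    (hf : Integrable (fun p : ℝ × X => f p.1 p.2) ((volume.restrict (Set.Icc 0 T)).prod μ))
    (h : ℝ → X → ℝ → ℝ)
    (hh_meas : Measurable fun p : ℝ × X × ℝ => h p.1 p.2.1 p.2.2)
    (hh_bdd : ∀ t x a, |h t x a| ≤ C)
    (hh_lip : ∀ t x a b, |h t x a - h t x b| ≤ C * |a - b|)
    (g : ℝ → X → ℝ → Y → ℝ)
    (hg_meas : Measurable fun p : ℝ × X × ℝ × Y => g p.1 p.2.1 p.2.2.1 p.2.2.2)
    (hg_bdd : ∀ t x s y, |g t x s y| ≤ L)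
    (hg_lip : ∀ t x s y, |g t x s y - g t x t y| ≤ L * |t - s|)
    (τ : ℝ) (hτ : τ ∈ Set.Ioo 0 (T / 2))
    (hg_supp : ∀ t x s y, t ∉ Set.Icc τ (T - τ) ∨ s ∉ Set.Icc τ (T - τ) → g t x s y = 0)
    (ρbar : ℝ → ℝ → ℝ)
    (hρbar : (∀ θ r, ρbar θ r = θ⁻¹ * ρ (θ⁻¹ * r)) ∨
      (∀ θ r, ρbar θ r = θ⁻¹ * ρ (θ⁻¹ * (-r)))) :
    Tendsto
      (fun θ : ℝ => ∫ t in Set.Icc (0 : ℝ) T, ∫ s in Set.Icc (0 : ℝ) T, ∫ x, ∫ y,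
          h t x (v s y) * f t x * g t x s y * ρbar θ (t - s) ∂ν ∂μ)
      (nhdsWithin 0 (Set.Ioi 0))
      (nhds (∫ t in Set.Icc (0 : ℝ) T, ∫ x, ∫ y,
          h t x (v t y) * f t x * g t x t y ∂ν ∂μ)) := by
  have hk : IsConcentratingKernel ρbar := by
    have hρk := isConcentratingKernel_rescale hρ_smooth.continuous hρ_nonneg hρ_bdd hρ_supp hρ_int
    rcases hρbar with hρbar | hρbar
    · rwa [show ρbar = fun θ r => θ⁻¹ * ρ (θ⁻¹ * r) from funext₂ hρbar]
    · rw [show ρbar = fun θ r => θ⁻¹ * ρ (θ⁻¹ * (-r)) from funext₂ hρbar]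
      exact hρk.comp_neg
  set I : Measure ℝ := volume.restrict (Set.Icc 0 T)
  set φ : ℝ → X → Y → ℝ → ℝ := fun t x y s => h t x (v s y) * g t x s y with hφ
  have hCL : 0 ≤ C * L := mul_nonneg hC hL
  have hφ_bdd : ∀ t x y s, |φ t x y s| ≤ C * L := fun t x y s => by
    rw [abs_mul]
    exact mul_le_mul (hh_bdd _ _ _) (hg_bdd _ _ _ _) (abs_nonneg _) hC
  have hφ_osc : ∀ t x y s, |φ t x y s - φ t x y t| ≤ C * L * (|v s y - v t y| + |t - s|) := by
    intro t x y s
    calc |φ t x y s - φ t x y t|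
        = |(h t x (v s y) - h t x (v t y)) * g t x s y
            + h t x (v t y) * (g t x s y - g t x t y)| := by simp only [hφ]; ring_nf
      _ ≤ |h t x (v s y) - h t x (v t y)| * |g t x s y|
            + |h t x (v t y)| * |g t x s y - g t x t y| := by
          rw [← abs_mul, ← abs_mul]; exact abs_add_le _ _
      _ ≤ (C * |v s y - v t y|) * L + C * (L * |t - s|) := by
          gcongr
          exacts [hh_lip _ _ _ _, hg_bdd _ _ _ _, hh_bdd _ _ _, hg_lip _ _ _ _]
      _ = _ := by ring
  have hmoll_bdd : ∀ θ, 0 < θ → ∀ t x y, |∫ s, φ t x y s * ρbar θ (t - s) ∂I| ≤ C * L := by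
    intro θ hθ t x y
    calc |∫ s, φ t x y s * ρbar θ (t - s) ∂I| ≤ ∫ s, C * L * ρbar θ (t - s) ∂I := by
          refine norm_integral_le_of_norm_le (f := fun s => φ t x y s * ρbar θ (t - s))
            ((hk.integrable_sub_left hθ t).integrableOn.const_mul _) (.of_forall fun s => ?_)
          rw [norm_mul, Real.norm_eq_abs, Real.norm_of_nonneg (hk.nonneg θ hθ _)]
          exact mul_le_mul_of_nonneg_right (hφ_bdd _ _ _ _) (hk.nonneg θ hθ _)
      _ ≤ C * L := by
          rw [integral_const_mul]
          exact mul_le_of_le_one_right hCL (hk.setIntegral_le_one hθ t _)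
  have hH : ∀ θ, 0 < θ → Integrable (fun q : (ℝ × X) × (ℝ × Y) =>
      f q.1.1 q.1.2 * (φ q.1.1 q.1.2 q.2.2 q.2.1 * ρbar θ (q.1.1 - q.2.1)))
      ((I.prod μ).prod (I.prod ν)) := by
    intro θ hθ
    refine (hf.comp_fst (I.prod ν)).mul_bdd (c := C * L * (2 / θ)) ?_ (.of_forall fun q => ?_)
    · exact ((aemeasurable_comp_mul_comp hh_meas hg_meas (by fun_prop) (by fun_prop)
        (by fun_prop) (by fun_prop) hv.aestronglyMeasurable.comp_snd.aemeasurable).mul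
        ((hk.measurable θ).comp (by fun_prop)).aemeasurable).aestronglyMeasurable
    · rw [norm_mul, Real.norm_eq_abs, Real.norm_of_nonneg (hk.nonneg θ hθ _)]
      exact mul_le_mul (hφ_bdd _ _ _ _) (hk.le θ hθ _) (hk.nonneg θ hθ _) hCL
  have hdiag : Integrable (fun q : (ℝ × X) × Y =>
      f q.1.1 q.1.2 * φ q.1.1 q.1.2 q.2 q.1.1) ((I.prod μ).prod ν) := by
    refine (hf.comp_fst ν).mul_bdd (c := C * L) ?_ (.of_forall fun q => hφ_bdd _ _ _ _)
    have hq : Measure.QuasiMeasurePreserving (Prod.map Prod.fst id : (ℝ × X) × Y → ℝ × Y)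
        ((I.prod μ).prod ν) (I.prod ν) :=
      MeasureTheory.QuasiMeasurePreserving.prodMap Measure.quasiMeasurePreserving_fst (.id ν)
    exact (aemeasurable_comp_mul_comp hh_meas hg_meas (by fun_prop) (by fun_prop)
      (by fun_prop) (by fun_prop)
      (hv.aestronglyMeasurable.comp_quasiMeasurePreserving hq).aemeasurable).aestronglyMeasurable
  have hlhs : ∀ θ, 0 < θ → ∫ t, ∫ s, ∫ x, ∫ y,
      h t x (v s y) * f t x * g t x s y * ρbar θ (t - s) ∂ν ∂μ ∂I ∂I
      = ∫ y, ∫ p, f p.1 p.2 * ∫ s, φ p.1 p.2 y s * ρbar θ (p.1 - s) ∂I ∂(I.prod μ) ∂ν := by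
    intro θ hθ
    simp_rw [← integral_const_mul]
    rw [← integral_prod_eq_integral_integral_integral (hH θ hθ),
      ← integral_integral_integral_integral_eq_integral_prod (hH θ hθ)]
    congr! 8
    simp only [hφ]
    ring
  have hrhs : ∫ t, ∫ x, ∫ y, h t x (v t y) * f t x * g t x t y ∂ν ∂μ ∂I
      = ∫ y, ∫ p, f p.1 p.2 * φ p.1 p.2 y p.1 ∂(I.prod μ) ∂ν := by
    rw [← integral_prod_symm _ hdiag, integral_prod _ hdiag,
      integral_prod _ hdiag.integral_prod_left]
    congr! 6
    simp only [hφ]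
    ring
  rw [hrhs]
  refine Tendsto.congr' (f₁ := fun θ =>
    ∫ y, ∫ p, f p.1 p.2 * ∫ s, φ p.1 p.2 y s * ρbar θ (p.1 - s) ∂I ∂(I.prod μ) ∂ν) ?_ ?_
  · filter_upwards [self_mem_nhdsWithin] with θ hθ using (hlhs θ hθ).symm
  have hf_bound : Integrable (fun p : ℝ × X => ‖f p.1 p.2‖ * (C * L)) (I.prod μ) :=
    hf.norm.mul_const _
  have hbound : ∀ θ, 0 < θ → ∀ (y : Y) (p : ℝ × X),
      ‖f p.1 p.2 * ∫ s, φ p.1 p.2 y s * ρbar θ (p.1 - s) ∂I‖ ≤ ‖f p.1 p.2‖ * (C * L) := by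
    intro θ hθ y p
    rw [norm_mul]
    exact mul_le_mul_of_nonneg_left (hmoll_bdd θ hθ _ _ _) (norm_nonneg _)
  refine tendsto_integral_filter_of_dominated_convergence
    (fun _ => ∫ p : ℝ × X, ‖f p.1 p.2‖ * (C * L) ∂(I.prod μ)) ?_ ?_ (integrable_const _) ?_
  · filter_upwards [self_mem_nhdsWithin] with θ hθ
    simp_rw [← integral_const_mul]
    exact aestronglyMeasurable_integral_integral (hH θ hθ)
  · filter_upwards [self_mem_nhdsWithin] with θ hθ
    exact .of_forall fun y => norm_integral_le_of_norm_le hf_bound (.of_forall (hbound θ hθ y))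
  filter_upwards [hv.prod_left_ae] with y hy
  refine tendsto_integral_filter_of_dominated_convergence _ ?_ ?_ hf_bound ?_
  · refine .of_forall fun θ => hf.aestronglyMeasurable.mul ?_
    refine AEStronglyMeasurable.integral_prod_right'
      (f := fun q : (ℝ × X) × ℝ => φ q.1.1 q.1.2 y q.2 * ρbar θ (q.1.1 - q.2)) ?_
    exact ((aemeasurable_comp_mul_comp hh_meas hg_meas (by fun_prop) (by fun_prop)
      (by fun_prop) (by fun_prop) hy.aestronglyMeasurable.comp_snd.aemeasurable).mul
      ((hk.measurable θ).comp (by fun_prop)).aemeasurable).aestronglyMeasurable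
  · filter_upwards [self_mem_nhdsWithin] with θ hθ using .of_forall (hbound θ hθ y)
  set u : ℝ → ℝ := (Set.Icc 0 T).indicator fun s => v s y with hu
  have hu_int : Integrable u := (integrable_indicator_iff measurableSet_Icc).2 hy
  have hleb : ∀ᵐ t, Tendsto (fun θ => ⨍ s in Metric.closedBall t θ, |u s - u t|)
      (nhdsWithin 0 (Set.Ioi 0)) (nhds 0) := by
    filter_upwards [(Besicovitch.vitaliFamily volume).ae_tendsto_average_norm_sub
      hu_int.locallyIntegrable] with t ht
    exact ht.comp (Besicovitch.tendsto_filterAt volume t)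
  filter_upwards [Measure.quasiMeasurePreserving_fst.ae (ae_restrict_of_ae hleb)] with p hp
  refine Tendsto.const_mul _ ?_
  by_cases hpτ : p.1 ∈ Set.Icc τ (T - τ)
  · have hmem : Set.Icc 0 T ∈ nhds p.1 :=
      Icc_mem_nhds (hτ.1.trans_le hpτ.1) (hpτ.2.trans_lt (sub_lt_self T hτ.1))
    refine hk.tendsto_setIntegral_mul hmem measurableSet_Icc hu_int hp ?_
      (hφ_bdd p.1 p.2 y) hCL fun s hs => ?_
    · exact (aemeasurable_comp_mul_comp hh_meas hg_meas measurable_const measurable_id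
        measurable_const measurable_const hy.aestronglyMeasurable.aemeasurable).aestronglyMeasurable
    · rw [hu, Set.indicator_of_mem hs, Set.indicator_of_mem (mem_of_mem_nhds hmem)]
      exact hφ_osc _ _ _ _
  · have hzero : ∀ s, φ p.1 p.2 y s = 0 := fun s => by
      simp only [hφ, hg_supp _ _ _ _ (Or.inl hpτ), mul_zero]
    simp [hzero]
end
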